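/- arXiv:1304.1555 — 5 statements merged into one kernel-verified Lean document; each statement's English description precedes it below -/
import Mathlib

section
/- Let {(|ψ_i⟩, p_i)}_{i=1}^k be an ensemble of linearly independent unit vectors in a finite-dimensional complex Hilbert space H, with p_i > 0 and Σ p_i = 1, let P_opt be the minimum error probability over all k-outcome POVMs, and let {|φ_i⟩}_{i=1}^k be the unique orthonormal family spanning span{|ψ_i⟩} characterizing optimal POVMs (a POVM is optimal iff it perfectly distinguishes the |φ_i⟩). Then for any sequence of k-outcome POVMs (Π_i^{(n)})_{n∈ℕ}: (1) if the error probabilities 1 − Σ_i p_i⟨ψ_i|Π_i^{(n)}|ψ_i⟩ converge to P_opt as n → ∞, then there exists a subsequence (n_j) along which Σ_{i=1}^k ⟨φ_i|Π_i^{(n_j)}|φ_i⟩ → k (i.e. the subsequence asymptotically perfectly distinguishes the |φ_i⟩); and (2) conversely, if a subsequence (n_j) satisfies Σ_{i=1}^k ⟨φ_i|Π_i^{(n_j)}|φ_i⟩ → k, then along that subsequence the error probabilities 1 − Σ_i p_i⟨ψ_i|Π_i^{(n_j)}|ψ_i⟩ converge to P_opt. -/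
open scoped InnerProductSpace
open Filter

/-- If the continuous functions `F`, `G` satisfy `F x = a → G x = b` on a compact set, then
`F ∘ u → a` implies `G ∘ u → b` for every `u` with values in that set. -/
theorem tendsto_of_isCompact_of_eq_imp_eq {ι X Y Z : Type*} [TopologicalSpace X]
    [TopologicalSpace Y] [T2Space Y] [TopologicalSpace Z] {K : Set X} (hK : IsCompact K)
    {F : X → Y} {G : X → Z} (hF : Continuous F) (hG : Continuous G) {a : Y} {b : Z}
    (h : ∀ x ∈ K, F x = a → G x = b) {l : Filter ι} {u : ι → X} (hu : ∀ n, u n ∈ K)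
    (hlim : Tendsto (fun n => F (u n)) l (nhds a)) : Tendsto (fun n => G (u n)) l (nhds b) := by
  rw [tendsto_iff_ultrafilter] at hlim ⊢
  intro g hg
  obtain ⟨x, hxK, hx⟩ := hK.ultrafilter_le_nhds (g.map u)
    (le_principal_iff.2 (Ultrafilter.mem_map.2 (Filter.univ_mem' hu)))
  have hx' : Tendsto u g (nhds x) := hx
  have hFx : F x = a := tendsto_nhds_unique ((hF.tendsto x).comp hx') (hlim g hg)
  exact h x hxK hFx ▸ (hG.tendsto x).comp hx'

theorem isCompact_setOf_povm {H : Type*} [NormedAddCommGroup H] [InnerProductSpace ℂ H]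
    [FiniteDimensional ℂ H] (ι : Type*) [Fintype ι] :
    IsCompact {T : ι → H →L[ℂ] H | (∀ i, (T i).IsPositive) ∧ ∑ i, T i = 1} := by
  have := FiniteDimensional.complete ℂ H
  have : ProperSpace (H →L[ℂ] H) := FiniteDimensional.proper ℂ _
  simp_rw [← ContinuousLinearMap.nonneg_iff_isPositive]
  refine Metric.isCompact_of_isClosed_isBounded ?_ ?_
  · have hnonneg : IsClosed {T : ι → H →L[ℂ] H | ∀ i, 0 ≤ T i} := by
      rw [Set.ofPred_forall]
      have hcone : IsClosed {S : H →L[ℂ] H | 0 ≤ S} := CStarAlgebra.isClosed_nonneg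
      exact isClosed_iInter fun i => hcone.preimage
        (f := fun T : ι → H →L[ℂ] H => T i) (continuous_apply i)
    exact hnonneg.inter (isClosed_eq (by fun_prop) continuous_const)
  · refine (Metric.isBounded_closedBall (x := 0) (r := 1)).subset fun T hT => ?_
    rw [mem_closedBall_zero_iff, pi_norm_le_iff_of_nonneg zero_le_one]
    intro i
    rw [CStarAlgebra.norm_le_one_iff_of_nonneg _ (hT.1 i), ← hT.2]
    exact Finset.single_le_sum (fun j _ => hT.1 j) (Finset.mem_univ i)

open scoped ComplexOrder in
/-- The diagonal probabilities of a POVM on a family of unit vectors sum up to the number of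
vectors iff the POVM distinguishes that family perfectly. -/
theorem sum_re_inner_eq_card_iff {H : Type*} [NormedAddCommGroup H] [InnerProductSpace ℂ H]
    {ι : Type*} [Fintype ι] [DecidableEq ι] {φ : ι → H}
    (hφ : ∀ i, ‖φ i‖ = 1) {T : ι → H →L[ℂ] H} (hpos : ∀ i, (T i).IsPositive)
    (hsum : ∑ i, T i = 1) :
    ∑ i, (⟪φ i, T i (φ i)⟫_ℂ).re = Fintype.card ι ↔
      ∀ i j, ⟪φ i, T j (φ i)⟫_ℂ = if i = j then 1 else 0 := by
  refine ⟨fun h => ?_, fun h => by simp [h]⟩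
  have hnonneg (i j) : 0 ≤ ⟪φ i, T j (φ i)⟫_ℂ := (hpos j).inner_nonneg_right (φ i)
  have hre (i j) : 0 ≤ (⟪φ i, T j (φ i)⟫_ℂ).re := (Complex.le_def.1 (hnonneg i j)).1
  have him (i j) : (⟪φ i, T j (φ i)⟫_ℂ).im = 0 := (Complex.le_def.1 (hnonneg i j)).2.symm
  have htotal (i) : ∑ j, (⟪φ i, T j (φ i)⟫_ℂ).re = 1 := by
    rw [← Complex.re_sum, ← inner_sum, ← sum_apply, hsum]
    simp [inner_self_eq_norm_sq_to_K, hφ]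
  have hle (i) : (⟪φ i, T i (φ i)⟫_ℂ).re ≤ 1 :=
    (Finset.single_le_sum (fun j _ => hre i j) (Finset.mem_univ i)).trans_eq (htotal i)
  have hdiag (i) : (⟪φ i, T i (φ i)⟫_ℂ).re = 1 :=
    (Finset.sum_eq_sum_iff_of_le fun i _ => hle i).1 (by simpa using h) i (Finset.mem_univ i)
  intro i j
  refine Complex.ext ?_ (by split_ifs <;> simp [him])
  split_ifs with hij
  · simpa [← hij] using hdiag i
  · have hoff : ∑ j ∈ Finset.univ.erase i, (⟪φ i, T j (φ i)⟫_ℂ).re = 0 := by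
      have := Finset.add_sum_erase Finset.univ (fun j => (⟪φ i, T j (φ i)⟫_ℂ).re)
        (Finset.mem_univ i)
      linarith [htotal i, hdiag i]
    simpa using (Finset.sum_eq_zero_iff_of_nonneg fun j _ => hre i j).1 hoff j
      (Finset.mem_erase.2 ⟨Ne.symm hij, Finset.mem_univ j⟩)

/-- Asymptotic version of the optimal-POVM characterization.  A sequence of
POVMs attains the minimum error `Popt` asymptotically iff it has a subsequence that
asymptotically perfectly distinguishes the unique optimal orthonormal family `φ`. -/
theorem asymptotic_optimal_povm_characterization
    {H : Type*} [NormedAddCommGroup H] [InnerProductSpace ℂ H] [FiniteDimensional ℂ H]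
    {k : ℕ} (ψ : Fin k → H) (p : Fin k → ℝ)
    (hunit : ∀ i, ‖ψ i‖ = 1) (hli : LinearIndependent ℂ ψ)
    (hp : ∀ i, 0 < p i) (hpsum : ∑ i, p i = 1)
    (Popt : ℝ)
    (hPopt : IsLeast
      {e : ℝ | ∃ T : Fin k → H →L[ℂ] H,
        (∀ i, (T i).IsPositive) ∧ (∑ i, T i) = 1 ∧
        e = 1 - ∑ i, p i * (⟪ψ i, (T i) (ψ i)⟫_ℂ).re} Popt)
    (φ : Fin k → H)
    (hON : Orthonormal ℂ φ)
    (hspan : Submodule.span ℂ (Set.range φ) = Submodule.span ℂ (Set.range ψ))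
    (hchar : ∀ T : Fin k → H →L[ℂ] H, (∀ i, (T i).IsPositive) → (∑ i, T i) = 1 →
      ((1 - ∑ i, p i * (⟪ψ i, (T i) (ψ i)⟫_ℂ).re = Popt) ↔
        ∀ i j, ⟪φ i, (T j) (φ i)⟫_ℂ = if i = j then 1 else 0))
    (T : ℕ → Fin k → H →L[ℂ] H)
    (hTpos : ∀ n i, (T n i).IsPositive) (hTsum : ∀ n, (∑ i, T n i) = 1) :
    (Tendsto (fun n => 1 - ∑ i, p i * (⟪ψ i, (T n i) (ψ i)⟫_ℂ).re) atTop (nhds Popt) →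
      ∃ nj : ℕ → ℕ, StrictMono nj ∧
        Tendsto (fun j => ∑ i, (⟪φ i, (T (nj j) i) (φ i)⟫_ℂ).re) atTop (nhds (k : ℝ))) ∧
    (∀ nj : ℕ → ℕ, StrictMono nj →
      Tendsto (fun j => ∑ i, (⟪φ i, (T (nj j) i) (φ i)⟫_ℂ).re) atTop (nhds (k : ℝ)) →
      Tendsto (fun j => 1 - ∑ i, p i * (⟪ψ i, (T (nj j) i) (ψ i)⟫_ℂ).re) atTop (nhds Popt)) := by
  have hK := isCompact_setOf_povm (H := H) (Fin k)
  have herr : Continuous fun S : Fin k → H →L[ℂ] H =>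
      1 - ∑ i, p i * (⟪ψ i, S i (ψ i)⟫_ℂ).re := by fun_prop
  have hdist : Continuous fun S : Fin k → H →L[ℂ] H =>
      ∑ i, (⟪φ i, S i (φ i)⟫_ℂ).re := by fun_prop
  have hiff (S : Fin k → H →L[ℂ] H) (hS : (∀ i, (S i).IsPositive) ∧ ∑ i, S i = 1) :
      1 - ∑ i, p i * (⟪ψ i, S i (ψ i)⟫_ℂ).re = Popt ↔
        ∑ i, (⟪φ i, S i (φ i)⟫_ℂ).re = k := by
    rw [hchar S hS.1 hS.2, ← sum_re_inner_eq_card_iff hON.1 hS.1 hS.2, Fintype.card_fin]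
  have hT (n : ℕ) := And.intro (hTpos n) (hTsum n)
  exact ⟨fun h => ⟨id, strictMono_id, tendsto_of_isCompact_of_eq_imp_eq hK herr hdist
      (fun S hS => (hiff S hS).1) hT h⟩,
    fun nj _ h => tendsto_of_isCompact_of_eq_imp_eq hK hdist herr
      (fun S hS => (hiff S hS).2) (fun j => hT (nj j)) h⟩
end

section
/- Let (Π_i)_{i=1}^k be a k-outcome POVM on a finite-dimensional complex Hilbert space H, let |ψ_i⟩ be unit vectors with probabilities p_i ≥ 0, Σ p_i = 1, and set Λ = Σ_{i=1}^k p_i Π_i |ψ_i⟩⟨ψ_i|. If Λ is Hermitian and Λ − p_j|ψ_j⟩⟨ψ_j| is positive semidefinite for every j, then Π_j(Λ − p_j|ψ_j⟩⟨ψ_j|) = 0 and (Λ − p_j|ψ_j⟩⟨ψ_j|)Π_j = 0 for every j. -/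
open scoped InnerProductSpace

/-- The rank-one operator `|ψ⟩⟨ψ| : x ↦ ⟪ψ, x⟫ • ψ`. -/
noncomputable def outerProj {H : Type*} [NormedAddCommGroup H] [InnerProductSpace ℂ H]
    (ψ : H) : H →L[ℂ] H :=
  (innerSL ℂ ψ).smulRight ψ

section PositiveProduct

open ContinuousLinearMap

variable {H : Type*} [NormedAddCommGroup H] [InnerProductSpace ℂ H] [FiniteDimensional ℂ H]

theorem trace_star_mul_self_eq_sum_norm_sq [CompleteSpace H] (X : H →L[ℂ] H) :
    LinearMap.trace ℂ H (star X * X : H →L[ℂ] H).toLinearMap =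
      ((∑ i, ‖X (stdOrthonormalBasis ℂ H i)‖ ^ 2 : ℝ) : ℂ) := by
  rw [LinearMap.trace_eq_sum_inner _ (stdOrthonormalBasis ℂ H)]
  push_cast
  refine Finset.sum_congr rfl fun i _ => ?_
  simp [star_eq_adjoint, adjoint_inner_right, inner_self_eq_norm_sq_to_K]

theorem eq_zero_of_sum_norm_sq_eq_zero {X : H →L[ℂ] H}
    (h : ∑ i, ‖X (stdOrthonormalBasis ℂ H i)‖ ^ 2 = 0) : X = 0 := by
  rw [Finset.sum_eq_zero_iff_of_nonneg fun i _ => by positivity] at h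
  refine ContinuousLinearMap.coe_injective ((stdOrthonormalBasis ℂ H).toBasis.ext fun i => ?_)
  simpa using h i (Finset.mem_univ i)

/-- The trace of a product of two positive operators is a nonnegative real number, which vanishes
only if the product does. -/
theorem ContinuousLinearMap.IsPositive.exists_trace_mul_eq [CompleteSpace H]
    {A B : H →L[ℂ] H} (hA : A.IsPositive) (hB : B.IsPositive) :
    ∃ r : ℝ, 0 ≤ r ∧ LinearMap.trace ℂ H (A * B : H →L[ℂ] H).toLinearMap = r ∧
      (r = 0 → A * B = 0) := by
  obtain ⟨S, rfl⟩ := CStarAlgebra.nonneg_iff_eq_star_mul_self.1 ((nonneg_iff_isPositive A).2 hA)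
  obtain ⟨R, rfl⟩ := CStarAlgebra.nonneg_iff_eq_star_mul_self.1 ((nonneg_iff_isPositive B).2 hB)
  refine ⟨∑ i, ‖(S * star R) (stdOrthonormalBasis ℂ H i)‖ ^ 2, by positivity, ?_, fun h => ?_⟩
  · rw [← trace_star_mul_self_eq_sum_norm_sq]
    calc LinearMap.trace ℂ H (star S * S * (star R * R) : H →L[ℂ] H).toLinearMap
        = LinearMap.trace ℂ H
            ((star S * S * star R : H →L[ℂ] H).toLinearMap * R.toLinearMap) := by
          rw [← mul_assoc]; rfl
      _ = LinearMap.trace ℂ H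
            (R.toLinearMap * (star S * S * star R : H →L[ℂ] H).toLinearMap) :=
          LinearMap.trace_mul_comm _ _ _
      _ = _ := by rw [star_mul, star_star, mul_assoc, mul_assoc, ← mul_assoc]; rfl
  · have hX : S * star R = 0 := eq_zero_of_sum_norm_sq_eq_zero h
    rw [show star S * S * (star R * R) = star S * (S * star R) * R by simp only [mul_assoc], hX]
    simp

end PositiveProduct

/-- If `Λ = Σ_i p_i Π_i |ψ_i⟩⟨ψ_i|` is Hermitian and
`Λ - p_j |ψ_j⟩⟨ψ_j| ≥ 0` for every `j`, then
`Π_j (Λ - p_j|ψ_j⟩⟨ψ_j|) = (Λ - p_j|ψ_j⟩⟨ψ_j|) Π_j = 0` for every `j`. -/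
theorem optimality_conditions_imply_annihilation
    {H : Type*} [NormedAddCommGroup H] [InnerProductSpace ℂ H] [FiniteDimensional ℂ H]
    {k : ℕ} (T : Fin k → H →L[ℂ] H)
    (hTpos : ∀ i, (T i).IsPositive) (hTsum : (∑ i, T i) = 1)
    (ψ : Fin k → H) (p : Fin k → ℝ)
    (hunit : ∀ i, ‖ψ i‖ = 1) (hp : ∀ i, 0 ≤ p i) (hpsum : ∑ i, p i = 1)
    (Λ : H →L[ℂ] H)
    (hΛ : Λ = ∑ i, (p i : ℂ) • ((T i).comp (outerProj (ψ i))))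
    (hherm : IsSelfAdjoint Λ)
    (hpos : ∀ j, (Λ - (p j : ℂ) • outerProj (ψ j)).IsPositive) :
    ∀ j, (T j).comp (Λ - (p j : ℂ) • outerProj (ψ j)) = 0 ∧
      (Λ - (p j : ℂ) • outerProj (ψ j)).comp (T j) = 0 := by
  have hsum : ∑ j, T j * (Λ - (p j : ℂ) • outerProj (ψ j)) = 0 := by
    simp_rw [mul_sub, Finset.sum_sub_distrib, ← Finset.sum_mul, hTsum, one_mul, mul_smul_comm]
    exact sub_eq_zero.2 hΛ
  choose r hr_nonneg hr_trace hr_zero using fun j => (hTpos j).exists_trace_mul_eq (hpos j)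
  have hr_sum : ∑ j, r j = 0 := by
    have h := congrArg (fun X : H →L[ℂ] H => LinearMap.trace ℂ H X.toLinearMap) hsum
    simp only [ContinuousLinearMap.toLinearMap_sum, map_sum, hr_trace,
      ContinuousLinearMap.toLinearMap_zero, map_zero] at h
    exact_mod_cast h
  intro j
  have hj : T j * (Λ - (p j : ℂ) • outerProj (ψ j)) = 0 :=
    hr_zero j ((Finset.sum_eq_zero_iff_of_nonneg fun i _ => hr_nonneg i).1 hr_sum j
      (Finset.mem_univ j))
  refine ⟨hj, ?_⟩
  have h := congrArg star hj
  rwa [star_mul, star_zero, (hTpos j).isSelfAdjoint.star_eq, (hpos j).isSelfAdjoint.star_eq] at h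
end

section
/- Let |ψ₀⟩, |ψ₁⟩, |ψ₂⟩ be unit vectors in ℂ² and p₀, p₁, p₂ ≥ 0 with p₀ + p₁ + p₂ = 1, and set Δ = p₀|ψ₀⟩⟨ψ₀| − p₁|ψ₁⟩⟨ψ₁| − p₂|ψ₂⟩⟨ψ₂| (a Hermitian operator on ℂ²) with real eigenvalues λ₁, λ₂. Then: (a) det Δ = p₁p₂(1 − |⟨ψ₁|ψ₂⟩|²) − p₀p₁(1 − |⟨ψ₀|ψ₁⟩|²) − p₀p₂(1 − |⟨ψ₀|ψ₂⟩|²); (b) if det Δ ≤ 0 then |λ₁| + |λ₂| = √(1 − 4p₁p₂(1 − |⟨ψ₁|ψ₂⟩|²) − 4p₀p₁|⟨ψ₀|ψ₁⟩|² − 4p₀p₂|⟨ψ₀|ψ₂⟩|²); (c) if det Δ ≥ 0 then |λ₁| + |λ₂| = |p₀ − p₁ − p₂|. -/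
open Matrix
open scoped ComplexOrder

/-- Lagrange's identity for unit vectors in `ℂ²`. -/
theorem one_sub_normSq_dotProduct {u v : Fin 2 → ℂ} (hu : star u ⬝ᵥ u = 1)
    (hv : star v ⬝ᵥ v = 1) :
    (1 - Complex.normSq (star u ⬝ᵥ v) : ℂ) =
      (u 0 * v 1 - u 1 * v 0) * (star (u 0) * star (v 1) - star (u 1) * star (v 0)) := by
  rw [Complex.normSq_eq_conj_mul_self]
  simp only [dotProduct, Fin.sum_univ_two, Pi.star_apply, RCLike.star_def, map_add, map_mul,
    Complex.conj_conj] at *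
  linear_combination -(starRingEnd ℂ (v 0) * v 0 + starRingEnd ℂ (v 1) * v 1) * hu - hv

/-- The determinant of a combination of three rank-one operators on `ℂ²`. -/
theorem det_sub_vecMulVec_star (u v w : Fin 2 → ℂ) (a b c : ℂ) :
    (a • vecMulVec u (star u) - b • vecMulVec v (star v) - c • vecMulVec w (star w)).det =
      b * c * ((v 0 * w 1 - v 1 * w 0) * (star (v 0) * star (w 1) - star (v 1) * star (w 0)))
      - a * b * ((u 0 * v 1 - u 1 * v 0) * (star (u 0) * star (v 1) - star (u 1) * star (v 0)))
      - a * c * ((u 0 * w 1 - u 1 * w 0) *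
        (star (u 0) * star (w 1) - star (u 1) * star (w 0))) := by
  simp only [det_fin_two, Matrix.sub_apply, Matrix.smul_apply, vecMulVec_apply,
    Pi.star_apply, smul_eq_mul]
  ring

theorem abs_add_abs_eq_sqrt_of_mul_nonpos {x y : ℝ} (h : x * y ≤ 0) :
    |x| + |y| = √((x + y) ^ 2 - 4 * (x * y)) := by
  have hxy : |x| * |y| = -(x * y) := by rw [← abs_mul, abs_of_nonpos h]
  rw [← Real.sqrt_sq (add_nonneg (abs_nonneg x) (abs_nonneg y))]
  congr 1
  linear_combination sq_abs x + sq_abs y + 2 * hxy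

theorem abs_add_abs_of_mul_nonneg {x y : ℝ} (h : 0 ≤ x * y) : |x| + |y| = |x + y| := by
  rcases mul_nonneg_iff.mp h with h | h
  · exact (abs_add_eq_add_abs_iff x y |>.mpr (.inl h)).symm
  · exact (abs_add_eq_add_abs_iff x y |>.mpr (.inr h)).symm

/-- trace norm of `Δ = p₀|ψ₀⟩⟨ψ₀| − p₁|ψ₁⟩⟨ψ₁| − p₂|ψ₂⟩⟨ψ₂|` on `ℂ²`:
determinant formula, and the value of `|λ₁| + |λ₂|` in the two determinant-sign cases. -/
theorem helstrom_mixed_pure (ψ0 ψ1 ψ2 : Fin 2 → ℂ) (p0 p1 p2 : ℝ)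
    (hψ0 : star ψ0 ⬝ᵥ ψ0 = 1) (hψ1 : star ψ1 ⬝ᵥ ψ1 = 1) (hψ2 : star ψ2 ⬝ᵥ ψ2 = 1)
    (hp0 : 0 ≤ p0) (hp1 : 0 ≤ p1) (hp2 : 0 ≤ p2) (hpsum : p0 + p1 + p2 = 1)
    (Δ : Matrix (Fin 2) (Fin 2) ℂ)
    (hΔdef : Δ = (p0 : ℂ) • vecMulVec ψ0 (star ψ0) - (p1 : ℂ) • vecMulVec ψ1 (star ψ1)
      - (p2 : ℂ) • vecMulVec ψ2 (star ψ2))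
    (hΔ : Δ.IsHermitian) :
    Δ.det = ((p1 * p2 * (1 - Complex.normSq (star ψ1 ⬝ᵥ ψ2))
        - p0 * p1 * (1 - Complex.normSq (star ψ0 ⬝ᵥ ψ1))
        - p0 * p2 * (1 - Complex.normSq (star ψ0 ⬝ᵥ ψ2)) : ℝ) : ℂ) ∧
    (Δ.det.re ≤ 0 →
      |hΔ.eigenvalues 0| + |hΔ.eigenvalues 1| =
        Real.sqrt (1 - 4 * p1 * p2 * (1 - Complex.normSq (star ψ1 ⬝ᵥ ψ2))
          - 4 * p0 * p1 * Complex.normSq (star ψ0 ⬝ᵥ ψ1)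
          - 4 * p0 * p2 * Complex.normSq (star ψ0 ⬝ᵥ ψ2))) ∧
    (0 ≤ Δ.det.re →
      |hΔ.eigenvalues 0| + |hΔ.eigenvalues 1| = |p0 - p1 - p2|) := by
  have hdet : Δ.det = ((p1 * p2 * (1 - Complex.normSq (star ψ1 ⬝ᵥ ψ2))
      - p0 * p1 * (1 - Complex.normSq (star ψ0 ⬝ᵥ ψ1))
      - p0 * p2 * (1 - Complex.normSq (star ψ0 ⬝ᵥ ψ2)) : ℝ) : ℂ) := by
    rw [hΔdef, det_sub_vecMulVec_star]
    push_cast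
    rw [one_sub_normSq_dotProduct hψ1 hψ2, one_sub_normSq_dotProduct hψ0 hψ1,
      one_sub_normSq_dotProduct hψ0 hψ2]
  have hprod : hΔ.eigenvalues 0 * hΔ.eigenvalues 1 = Δ.det.re := by
    rw [hΔ.det_eq_prod_eigenvalues]
    simp [Fin.prod_univ_two]
  have hsum : hΔ.eigenvalues 0 + hΔ.eigenvalues 1 = p0 - p1 - p2 := by
    have htr : Δ.trace = ((p0 - p1 - p2 : ℝ) : ℂ) := by
      rw [hΔdef]
      simp [trace_sub, trace_smul, trace_vecMulVec, dotProduct_comm _ (star _), hψ0, hψ1, hψ2]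
    rw [hΔ.trace_eq_sum_eigenvalues, Fin.sum_univ_two] at htr
    simpa using congrArg Complex.re htr
  refine ⟨hdet, fun h => ?_, fun h => ?_⟩
  · rw [abs_add_abs_eq_sqrt_of_mul_nonpos (hprod ▸ h), hprod, hsum, hdet, Complex.ofReal_re]
    congr 1
    linear_combination (p0 + p1 + p2 + 1) * hpsum
  · rw [abs_add_abs_of_mul_nonneg (hprod ▸ h), hsum]
end

section
/- For real θ, φ and k ∈ {0,1,2} define p_k = (2/3)·|cos(2πk/3)·cos θ + e^{iφ}·sin(2πk/3)·sin θ|². Then p₀ + p₁ + p₂ = 1 and 1 − 3p₁p₂ − p₀p₁ − p₀p₂ = (1/144)·(75 + 32 cos(2θ) − 7 cos(4θ) + 18 cos(2φ) sin²(2θ)). -/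
theorem normSq_add_exp_mul_I_mul (φ a b : ℝ) :
    Complex.normSq ((a : ℂ) + Complex.exp (φ * Complex.I) * (b : ℂ)) =
      a ^ 2 + b ^ 2 + 2 * a * b * Real.cos φ := by
  simp only [Complex.normSq_apply, Complex.add_re, Complex.add_im, Complex.mul_re, Complex.mul_im,
    Complex.ofReal_re, Complex.ofReal_im, Complex.exp_ofReal_mul_I_re,
    Complex.exp_ofReal_mul_I_im]
  linear_combination b ^ 2 * Real.sin_sq_add_cos_sq φ

theorem cos_two_pi_div_three : Real.cos (2 * Real.pi / 3) = -(1 / 2) := by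
  rw [show 2 * Real.pi / 3 = Real.pi - Real.pi / 3 by ring, Real.cos_pi_sub, Real.cos_pi_div_three]

theorem sin_two_pi_div_three : Real.sin (2 * Real.pi / 3) = √3 / 2 := by
  rw [show 2 * Real.pi / 3 = Real.pi - Real.pi / 3 by ring, Real.sin_pi_sub, Real.sin_pi_div_three]

theorem cos_four_pi_div_three : Real.cos (2 * Real.pi * 2 / 3) = -(1 / 2) := by
  rw [show 2 * Real.pi * 2 / 3 = Real.pi / 3 + Real.pi by ring, Real.cos_add_pi,
    Real.cos_pi_div_three]

theorem sin_four_pi_div_three : Real.sin (2 * Real.pi * 2 / 3) = -(√3 / 2) := by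
  rw [show 2 * Real.pi * 2 / 3 = Real.pi / 3 + Real.pi by ring, Real.sin_add_pi,
    Real.sin_pi_div_three]


/-- For the posterior probabilities
`p_k = (2/3)|cos(2πk/3)cos θ + e^{iφ} sin(2πk/3) sin θ|²` of the trine states,
`p₀ + p₁ + p₂ = 1` and
`1 − 3p₁p₂ − p₀p₁ − p₀p₂ = (1/144)(75 + 32cos 2θ − 7cos 4θ + 18cos 2φ sin² 2θ)`. -/
theorem trine_posterior_identities (θ φ : ℝ) (p : Fin 3 → ℝ)
    (hp : ∀ k : Fin 3, p k = (2 / 3) * Complex.normSq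
      ((Real.cos (2 * Real.pi * (k : ℕ) / 3) * Real.cos θ : ℝ) +
        Complex.exp (φ * Complex.I) * ((Real.sin (2 * Real.pi * (k : ℕ) / 3) * Real.sin θ : ℝ)))) :
    p 0 + p 1 + p 2 = 1 ∧
    1 - 3 * p 1 * p 2 - p 0 * p 1 - p 0 * p 2 =
      (1 / 144) * (75 + 32 * Real.cos (2 * θ) - 7 * Real.cos (4 * θ)
        + 18 * Real.cos (2 * φ) * Real.sin (2 * θ) ^ 2) := by
  have h3 : √3 ^ 2 = (3 : ℝ) := Real.sq_sqrt (by norm_num)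
  have hs : Real.sin θ ^ 2 = 1 - Real.cos θ ^ 2 := Real.sin_sq θ
  have h0 : p 0 = 2 / 3 * Real.cos θ ^ 2 := by
    rw [hp, normSq_add_exp_mul_I_mul]
    simp
  have h1 : p 1 = 1 / 2 - 1 / 3 * Real.cos θ ^ 2
      - √3 / 3 * Real.cos θ * Real.sin θ * Real.cos φ := by
    rw [hp, normSq_add_exp_mul_I_mul]
    simp only [Fin.val_one, Nat.cast_one, mul_one, cos_two_pi_div_three, sin_two_pi_div_three]
    linear_combination (1 / 6) * Real.sin θ ^ 2 * h3 + (1 / 2) * hs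
  have h2 : p 2 = 1 / 2 - 1 / 3 * Real.cos θ ^ 2
      + √3 / 3 * Real.cos θ * Real.sin θ * Real.cos φ := by
    rw [hp, normSq_add_exp_mul_I_mul]
    simp only [Fin.val_two, Nat.cast_ofNat, cos_four_pi_div_three, sin_four_pi_div_three]
    linear_combination (1 / 6) * Real.sin θ ^ 2 * h3 + (1 / 2) * hs
  refine ⟨by rw [h0, h1, h2]; ring, ?_⟩
  rw [h0, h1, h2, show 4 * θ = 2 * (2 * θ) by ring, Real.cos_two_mul (2 * θ), Real.cos_two_mul θ,
    Real.cos_two_mul φ, Real.sin_two_mul]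
  linear_combination (1 / 3) * Real.cos θ ^ 2 * Real.sin θ ^ 2 * Real.cos φ ^ 2 * h3
    + (1 / 2) * Real.cos θ ^ 2 * hs
end

section
/- For all real θ ∈ [−π/6, π/6] and all real φ: 75 + 32 cos(2θ) − 7 cos(4θ) + 18 cos(2φ) sin²(2θ) ≤ 108, and equality holds at θ = −π/6, φ = 0. Consequently, on this range the expression 1/2 − (1/24)·√(75 + 32 cos(2θ) − 7 cos(4θ) + 18 cos(2φ) sin²(2θ)) attains its minimum value 1/2 − √3/4 at θ = −π/6, φ = 0. -/
open Real

/-- The radicand of the one-way bound never exceeds `108`: at `cos 2φ = 1` the gap is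
`8 (2 cos 2θ - 1)²`. -/
theorem one_way_radicand_le (θ φ : ℝ) :
    75 + 32 * cos (2 * θ) - 7 * cos (4 * θ) + 18 * cos (2 * φ) * sin (2 * θ) ^ 2 ≤ 108 := by
  have h4 : cos (4 * θ) = 2 * cos (2 * θ) ^ 2 - 1 := by
    rw [← cos_two_mul]
    ring_nf
  have hφ : cos (2 * φ) * sin (2 * θ) ^ 2 ≤ sin (2 * θ) ^ 2 :=
    mul_le_of_le_one_left (sq_nonneg _) (cos_le_one _)
  nlinarith [sin_sq_add_cos_sq (2 * θ), sq_nonneg (2 * cos (2 * θ) - 1)]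

theorem one_way_radicand_eq :
    75 + 32 * cos (2 * (-(π / 6))) - 7 * cos (4 * (-(π / 6)))
      + 18 * cos (2 * 0) * sin (2 * (-(π / 6))) ^ 2 = 108 := by
  have h2 : cos (2 * (-(π / 6))) = 1 / 2 := by
    rw [← cos_pi_div_three, ← cos_neg (π / 3)]
    ring_nf
  have h4 : cos (4 * (-(π / 6))) = 2 * cos (2 * (-(π / 6))) ^ 2 - 1 := by
    rw [← cos_two_mul]
    ring_nf
  rw [h4, sin_sq, h2, mul_zero, cos_zero]
  norm_num

theorem sqrt_one_hundred_eight : Real.sqrt 108 = 6 * Real.sqrt 3 := by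
  rw [show (108 : ℝ) = 6 ^ 2 * 3 by norm_num, sqrt_mul (by positivity), sqrt_sq (by norm_num)]

/-- On `θ ∈ [−π/6, π/6]`, `φ ∈ ℝ`,
`75 + 32cos 2θ − 7cos 4θ + 18cos 2φ sin² 2θ ≤ 108` with equality at `θ = −π/6, φ = 0`;
consequently `1/2 − (1/24)√(…)` attains its minimum `1/2 − √3/4` at `θ = −π/6, φ = 0`. -/
theorem one_way_bound_optimization :
    (∀ θ φ : ℝ, θ ∈ Set.Icc (-(π / 6)) (π / 6) →
      75 + 32 * cos (2 * θ) - 7 * cos (4 * θ) + 18 * cos (2 * φ) * sin (2 * θ) ^ 2 ≤ 108) ∧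
    (75 + 32 * cos (2 * (-(π / 6))) - 7 * cos (4 * (-(π / 6)))
      + 18 * cos (2 * 0) * sin (2 * (-(π / 6))) ^ 2 = 108) ∧
    (∀ θ φ : ℝ, θ ∈ Set.Icc (-(π / 6)) (π / 6) →
      1 / 2 - Real.sqrt 3 / 4 ≤
        1 / 2 - (1 / 24) * Real.sqrt (75 + 32 * cos (2 * θ) - 7 * cos (4 * θ)
          + 18 * cos (2 * φ) * sin (2 * θ) ^ 2)) ∧
    (1 / 2 - (1 / 24) * Real.sqrt (75 + 32 * cos (2 * (-(π / 6))) - 7 * cos (4 * (-(π / 6)))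
        + 18 * cos (2 * 0) * sin (2 * (-(π / 6))) ^ 2) = 1 / 2 - Real.sqrt 3 / 4) := by
  refine ⟨fun θ φ _ => one_way_radicand_le θ φ, one_way_radicand_eq, fun θ φ _ => ?_, ?_⟩
  · have h := sqrt_le_sqrt (one_way_radicand_le θ φ)
    rw [sqrt_one_hundred_eight] at h
    linarith
  · rw [one_way_radicand_eq, sqrt_one_hundred_eight]
    ring
end
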